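/- Let p ≥ 5 be a prime, d = (p−1)/2, g ≥ 3, and 1 ≤ c ≤ d−1. There is no small admissible p-coloring σ = (a_1,…,a_g, b_1,…,b_g, c_1,…,c_{g−2}) in C_p(g,c,1) such that d−1−a_i−2b_i ≡ d−1 (mod 2d) for all 1 ≤ i ≤ g−2, d−1−a_{g−1}−2b_{g−1} ≡ d−2 (mod 2d), and d−1−a_g−2b_g ≡ d−c+1 (mod 2d). -/

import Mathlib

/-- Admissibility of a triple of colors meeting at a vertex:
even sum, triangle inequalities, and sum at most `2p - 4`. -/
def AdmTriple (p i j k : ℕ) : Prop :=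
  (i + j + k) % 2 = 0 ∧ i ≤ j + k ∧ j ≤ i + k ∧ k ≤ i + j ∧ i + j + k ≤ 2 * p - 4

/-- `(a, b, cc)` is a small admissible `p`-coloring of type `(c, ε)` of the lollipop
tree `G_g`.  The relevant indices are `a i`, `b i` for `1 ≤ i ≤ g` (the `i`-th stick
edge has color `2 * a i` and the `i`-th loop edge has color `a i + b i`) and `cc j`
for `1 ≤ j ≤ g - 2` (the colors of the internal edges of the spine). -/
def IsSmallAdmissible (p g c ε : ℕ) (a b cc : ℕ → ℕ) : Prop :=
  -- (1) admissibility at the `g - 1` trivalent vertices of the spine: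
  -- the triples `(2a_1, 2a_2, c_1)`, `(c_{j-1}, 2a_{j+1}, c_j)` for `2 ≤ j ≤ g-2`,
  -- and `(c_{g-2}, 2a_g, 2c)` are admissible
  (∀ j, 1 ≤ j → j ≤ g - 1 →
      AdmTriple p (if j = 1 then 2 * a 1 else cc (j - 1)) (2 * a (j + 1))
        (if j ≤ g - 2 then cc j else 2 * c)) ∧
  -- (2) admissibility at the trivalent vertex of each lollipop
  (∀ i, 1 ≤ i → i ≤ g → 2 * (a i + b i) + 2 * a i ≤ 2 * p - 4) ∧
  -- (3) all colors are at most `p - 2`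
  (∀ i, 1 ≤ i → i ≤ g → 2 * a i ≤ p - 2 ∧ a i + b i ≤ p - 2) ∧
  (∀ j, 1 ≤ j → j ≤ g - 2 → cc j ≤ p - 2) ∧
  2 * c ≤ p - 2 ∧
  -- (4) the coloring has type `(c, ε)`
  (c + ∑ i ∈ Finset.Icc 1 g, a i) ≡ ε [MOD 2] ∧
  -- (5) smallness
  (∀ i, 1 ≤ i → i ≤ g → a i + b i ≤ (p - 1) / 2 - 1)

/-- There is no small admissible `p`-coloring of type `(c, 1)` whose weight is
congruent (mod `2d`) to `d - 1` in coordinates `1, …, g-2`, to `d - 2` in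
coordinate `g-1`, and to `d - c + 1` in coordinate `g`. -/
theorem stmt12 (p d g c : ℕ) (hp : p.Prime) (hp5 : 5 ≤ p) (hd : d = (p - 1) / 2)
    (hg : 3 ≤ g) (hc1 : 1 ≤ c) (hc : c ≤ d - 1) :
    ¬ ∃ a b cc : ℕ → ℕ, IsSmallAdmissible p g c 1 a b cc ∧
      (∀ i, 1 ≤ i → i ≤ g - 2 →
        (d : ℤ) - 1 - a i - 2 * b i ≡ (d : ℤ) - 1 [ZMOD 2 * (d : ℤ)]) ∧
      (d : ℤ) - 1 - a (g - 1) - 2 * b (g - 1) ≡ (d : ℤ) - 2 [ZMOD 2 * (d : ℤ)] ∧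
      (d : ℤ) - 1 - a g - 2 * b g ≡ (d : ℤ) - c + 1 [ZMOD 2 * (d : ℤ)] := by
  rintro ⟨a, b, cc, ⟨h1, -, -, -, -, -, h5⟩, hw, hw1, hw2⟩
  have key : ∀ x : ℤ, (2 * (d : ℤ)) ∣ x → |x| < 2 * (d : ℤ) → x = 0 :=
    fun x hx hl => Int.eq_zero_of_abs_lt_dvd hx hl
  have hd2 : 2 ≤ d := by omega
  -- the first `g - 2` stick colors vanish
  have ha : ∀ i, 1 ≤ i → i ≤ g - 2 → a i = 0 := by
    intro i hi hi'
    have hs := h5 i hi (by omega)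
    have := key ((d : ℤ) - 1 - ((d : ℤ) - 1 - a i - 2 * b i)) (hw i hi hi').dvd
      (by rw [abs_lt]; constructor <;> omega)
    omega
  have ha1 : a (g - 1) = 1 := by
    have hs := h5 (g - 1) (by omega) (by omega)
    have := key ((d : ℤ) - 2 - ((d : ℤ) - 1 - a (g - 1) - 2 * b (g - 1))) hw1.dvd
      (by rw [abs_lt]; constructor <;> omega)
    omega
  have ha2 : a g + 2 ≤ c := by
    have hs := h5 g (by omega) le_rfl
    have := key ((d : ℤ) - c + 1 - ((d : ℤ) - 1 - a g - 2 * b g)) hw2.dvd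
      (by rw [abs_lt]; constructor <;> omega)
    omega
  -- the left edge at each of the first `g - 2` spine vertices has color `0`
  have hL : ∀ j, 1 ≤ j → j ≤ g - 2 → (if j = 1 then 2 * a 1 else cc (j - 1)) = 0 := by
    intro j hj
    induction j, hj using Nat.le_induction with
    | base => intro _; simp [ha 1 le_rfl (by omega)]
    | succ j hj ih =>
      intro hj'
      have h := h1 j hj (by omega)
      rw [ih (by omega), ha (j + 1) (by omega) hj', if_pos (by omega)] at h
      obtain ⟨_, _, _, h4, _⟩ := h
      rw [if_neg (by omega)]
      simpa using h4
  have hA := h1 (g - 2) (by omega) (by omega)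
  rw [hL (g - 2) (by omega) le_rfl, if_pos le_rfl, show g - 2 + 1 = g - 1 by omega, ha1] at hA
  have hB := h1 (g - 1) (by omega) le_rfl
  rw [if_neg (by omega), if_neg (by omega), show g - 1 - 1 = g - 2 by omega,
    show g - 1 + 1 = g by omega] at hB
  obtain ⟨_, _, _, hA4, _⟩ := hA
  obtain ⟨_, _, _, hB4, _⟩ := hB
  omega
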